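/- Let L, M, N be positive integers and let G be a finite simple graph whose vertex set is partitioned into three disjoint sets S, A, B such that A is an independent set of G and B is an independent set of G. If |S| + |A| ≤ L·M and |S| + |B| ≤ L·N, then G is a minor of the Chimera graph C_{L,M,N}. -/

import Mathlib

/-- `G` is a minor of `H`: each vertex of `G` is assigned a nonempty set of vertices of `H`,
the sets are pairwise disjoint, each induces a connected subgraph of `H`, and every edge of
`G` is represented by an edge of `H` between the corresponding sets. -/
def IsMinor {V W : Type*} (G : SimpleGraph V) (H : SimpleGraph W) : Prop :=
  ∃ φ : V → Set W,
    (∀ u, (φ u).Nonempty) ∧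
    (Pairwise fun u v => Disjoint (φ u) (φ v)) ∧
    (∀ u, (H.induce (φ u)).Connected) ∧
    (∀ u v, G.Adj u v → ∃ u' ∈ φ u, ∃ v' ∈ φ v, H.Adj u' v')

/-- The Chimera graph `C_{L,M,N}`: an `M × N` grid of `K_{L,L}` cells.  A vertex
`(r, c, p, h)` has row `r`, column `c`, partite index `p`, and in-cell height `h`.
Vertices are adjacent iff they are in the same cell with different partite indices
(intra-cell edges), or they are in partite set `0` with equal column and height and
adjacent rows (vertical inter-cell edges), or they are in partite set `1` with equal
row and height and adjacent columns (horizontal inter-cell edges). -/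
def chimera (L M N : ℕ) : SimpleGraph (Fin M × Fin N × Fin 2 × Fin L) :=
  SimpleGraph.fromRel fun x y =>
    (x.1 = y.1 ∧ x.2.1 = y.2.1 ∧ x.2.2.1 ≠ y.2.2.1) ∨
    (x.2.2.1 = 0 ∧ y.2.2.1 = 0 ∧ x.2.1 = y.2.1 ∧ x.2.2.2 = y.2.2.2 ∧
      ((x.1 : ℕ) + 1 = (y.1 : ℕ) ∨ (y.1 : ℕ) + 1 = (x.1 : ℕ))) ∨
    (x.2.2.1 = 1 ∧ y.2.2.1 = 1 ∧ x.1 = y.1 ∧ x.2.2.2 = y.2.2.2 ∧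
      ((x.2.1 : ℕ) + 1 = (y.2.1 : ℕ) ∨ (y.2.1 : ℕ) + 1 = (x.2.1 : ℕ)))

namespace SimpleGraph

theorem Connected.induce_range {V W : Type*} {G : SimpleGraph V} {H : SimpleGraph W}
    (hG : G.Connected) (f : G →g H) : (H.induce (Set.range f)).Connected :=
  hG.map (H := H.induce (Set.range f)) ⟨Set.rangeFactorization f, fun h => f.map_adj h⟩
    Set.rangeFactorization_surjective

theorem pathGraph_connected_of_pos {n : ℕ} (hn : 0 < n) : (pathGraph n).Connected := by
  obtain ⟨k, rfl⟩ := Nat.exists_eq_succ_of_ne_zero hn.ne'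
  exact pathGraph_connected k

end SimpleGraph

namespace chimera

variable {L M N : ℕ}

/-- The horizontal line of the Chimera graph in a given row and at a given height. -/
def horizontalLine (N : ℕ) (p : Fin M × Fin L) : Set (Fin M × Fin N × Fin 2 × Fin L) :=
  Set.range fun c => (p.1, c, 1, p.2)

/-- The vertical line of the Chimera graph in a given column and at a given height. -/
def verticalLine (M : ℕ) (q : Fin N × Fin L) : Set (Fin M × Fin N × Fin 2 × Fin L) :=
  Set.range fun r => (r, q.1, 0, q.2)

theorem induce_horizontalLine_connected (hN : 0 < N) (p : Fin M × Fin L) :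
    ((chimera L M N).induce (horizontalLine N p)).Connected :=
  (SimpleGraph.pathGraph_connected_of_pos hN).induce_range (H := chimera L M N)
    ⟨fun c => (p.1, c, 1, p.2), fun {a b} h => by
      have hne := h.ne
      rw [SimpleGraph.pathGraph_adj] at h
      simp [chimera, hne, h]⟩

theorem induce_verticalLine_connected (hM : 0 < M) (q : Fin N × Fin L) :
    ((chimera L M N).induce (verticalLine M q)).Connected :=
  (SimpleGraph.pathGraph_connected_of_pos hM).induce_range (H := chimera L M N)
    ⟨fun r => (r, q.1, 0, q.2), fun {a b} h => by
      have hne := h.ne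
      rw [SimpleGraph.pathGraph_adj] at h
      simp [chimera, hne, h]⟩

theorem exists_adj_horizontalLine_verticalLine (p : Fin M × Fin L) (q : Fin N × Fin L) :
    ∃ x ∈ horizontalLine N p, ∃ y ∈ verticalLine M q, (chimera L M N).Adj x y :=
  ⟨_, ⟨q.1, rfl⟩, _, ⟨p.1, rfl⟩, by simp [chimera]⟩

theorem horizontalLine_disjoint {p p' : Fin M × Fin L} (h : p ≠ p') :
    Disjoint (horizontalLine N p) (horizontalLine N p') := by
  rw [Set.disjoint_left]
  rintro _ ⟨c, rfl⟩ ⟨c', hc⟩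
  simp only [Prod.mk.injEq] at hc
  exact h (Prod.ext hc.1.symm hc.2.2.2.symm)

theorem verticalLine_disjoint {q q' : Fin N × Fin L} (h : q ≠ q') :
    Disjoint (verticalLine M q) (verticalLine M q') := by
  rw [Set.disjoint_left]
  rintro _ ⟨r, rfl⟩ ⟨r', hr⟩
  simp only [Prod.mk.injEq] at hr
  exact h (Prod.ext hr.2.1.symm hr.2.2.2.symm)

theorem horizontalLine_disjoint_verticalLine (p : Fin M × Fin L) (q : Fin N × Fin L) :
    Disjoint (horizontalLine N p) (verticalLine M q) := by
  rw [Set.disjoint_left]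
  rintro _ ⟨c, rfl⟩ ⟨r, hr⟩
  simp at hr

end chimera

theorem Set.exists_injOn_fin_prod {V : Type*} [Finite V] {m n : ℕ} (hm : 0 < m) (hn : 0 < n)
    (s : Set V) (hs : s.ncard ≤ n * m) : ∃ f : V → Fin m × Fin n, Set.InjOn f s := by
  have : Nonempty (Fin m × Fin n) := ⟨⟨0, hm⟩, ⟨0, hn⟩⟩
  obtain ⟨f, -, hf⟩ := s.toFinite.exists_injOn_of_encard_le
    (t := (Set.univ : Set (Fin m × Fin n))) (by
      rw [← s.toFinite.cast_ncard_eq, ← Set.finite_univ.cast_ncard_eq, Set.ncard_univ]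
      simpa [mul_comm m n] using Nat.cast_le (α := ℕ∞).mpr hs)
  exact ⟨f, hf⟩

open chimera in
/-- Two sets `P` and `Q` that cover the vertices of `G` and have independent complements yield a
minor embedding, in which `P` receives horizontal lines and `Q` receives vertical lines. -/
theorem isMinor_chimera_of_injOn {V : Type*} {L M N : ℕ} (hM : 0 < M) (hN : 0 < N)
    (G : SimpleGraph V) (P Q : Set V) (hPQ : ∀ u, u ∈ P ∨ u ∈ Q)
    (hP : ∀ u v, G.Adj u v → u ∈ P ∨ v ∈ P) (hQ : ∀ u v, G.Adj u v → u ∈ Q ∨ v ∈ Q)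
    (f : V → Fin M × Fin L) (g : V → Fin N × Fin L)
    (hf : Set.InjOn f P) (hg : Set.InjOn g Q) : IsMinor G (chimera L M N) := by
  let φ : V → Set (Fin M × Fin N × Fin 2 × Fin L) := fun u =>
    {x | u ∈ P ∧ x ∈ horizontalLine N (f u)} ∪ {x | u ∈ Q ∧ x ∈ verticalLine M (g u)}
  have connected (u : V) : ((chimera L M N).induce (φ u)).Connected := by
    have hconn := induce_horizontalLine_connected hN (f u)
    have vconn := induce_verticalLine_connected hM (g u)
    by_cases huP : u ∈ P <;> by_cases huQ : u ∈ Q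
    · obtain ⟨x, hx, y, hy, hxy⟩ := exists_adj_horizontalLine_verticalLine (f u) (g u)
      have h : φ u = horizontalLine N (f u) ∪ verticalLine M (g u) := by
        ext; simp [φ, huP, huQ]
      exact h ▸ SimpleGraph.connected_induce_union hconn.preconnected vconn.preconnected hx hy hxy
    · have h : φ u = horizontalLine N (f u) := by
        ext; simp [φ, huP, huQ]
      exact h ▸ hconn
    · have h : φ u = verticalLine M (g u) := by
        ext; simp [φ, huP, huQ]
      exact h ▸ vconn
    · exact ((hPQ u).elim huP huQ).elim
  have exists_adj {u v : V} (hu : u ∈ P) (hv : v ∈ Q) :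
      ∃ x ∈ φ u, ∃ y ∈ φ v, (chimera L M N).Adj x y := by
    obtain ⟨x, hx, y, hy, hxy⟩ := exists_adj_horizontalLine_verticalLine (f u) (g v)
    exact ⟨x, .inl ⟨hu, hx⟩, y, .inr ⟨hv, hy⟩, hxy⟩
  refine ⟨φ, fun u => Set.nonempty_coe_sort.mp (connected u).nonempty, fun u v huv => ?_,
    connected, fun u v huv => ?_⟩
  · refine Set.disjoint_left.mpr ?_
    rintro x (⟨hu, hx⟩ | ⟨hu, hx⟩) (⟨hv, hy⟩ | ⟨hv, hy⟩)
    · exact (horizontalLine_disjoint (hf.ne hu hv huv)).le_bot ⟨hx, hy⟩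
    · exact (horizontalLine_disjoint_verticalLine _ _).le_bot ⟨hx, hy⟩
    · exact (horizontalLine_disjoint_verticalLine _ _).le_bot ⟨hy, hx⟩
    · exact (verticalLine_disjoint (hg.ne hu hv huv)).le_bot ⟨hx, hy⟩
  · have h : (u ∈ P ∧ v ∈ Q) ∨ (v ∈ P ∧ u ∈ Q) := by
      grind
    obtain ⟨hu, hv⟩ | ⟨hv, hu⟩ := h
    · exact exists_adj hu hv
    · obtain ⟨x, hx, y, hy, hxy⟩ := exists_adj hv hu
      exact ⟨y, hy, x, hx, hxy.symm⟩

/-- If the vertex set of a finite graph `G` is partitioned into `S ∪ A ∪ B` with `A`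
and `B` independent sets, `|S| + |A| ≤ L·M`, and `|S| + |B| ≤ L·N`, then `G` is a
minor of the Chimera graph `C_{L,M,N}`. -/
theorem isMinor_chimera_of_oct_decomposition {V : Type*} [Fintype V]
    (L M N : ℕ) (hL : 0 < L) (hM : 0 < M) (hN : 0 < N)
    (G : SimpleGraph V) (S A B : Set V)
    (hSA : Disjoint S A) (hSB : Disjoint S B) (hAB : Disjoint A B)
    (hcover : S ∪ A ∪ B = Set.univ)
    (hA : ∀ u ∈ A, ∀ v ∈ A, ¬ G.Adj u v)
    (hB : ∀ u ∈ B, ∀ v ∈ B, ¬ G.Adj u v)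
    (hsizeA : S.ncard + A.ncard ≤ L * M) (hsizeB : S.ncard + B.ncard ≤ L * N) :
    IsMinor G (chimera L M N) := by
  have cover (u : V) : u ∈ S ∨ u ∈ A ∨ u ∈ B := by
    have hu : u ∈ S ∪ A ∪ B := hcover ▸ Set.mem_univ u
    simpa [or_assoc] using hu
  obtain ⟨f, hf⟩ := (S ∪ A).exists_injOn_fin_prod hM hL ((Set.ncard_union_le S A).trans hsizeA)
  obtain ⟨g, hg⟩ := (S ∪ B).exists_injOn_fin_prod hN hL ((Set.ncard_union_le S B).trans hsizeB)
  refine isMinor_chimera_of_injOn hM hN G (S ∪ A) (S ∪ B) ?_ ?_ ?_ f g hf hg <;>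
    grind
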